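/- (Bellman recursion for unconstrained one-dimensional K-means, the basis of the dynamic program of Wang and Song.) Let x_1 ≤ … ≤ x_N be sorted real data. For 1 ≤ m ≤ i ≤ N, let D[i, m] denote the minimum cost over all contiguous m-partitions of {1, …, i}. Then D[i, 1] = W[1, i] for all i, and for all 2 ≤ m ≤ i ≤ N, D[i, m] = min_{j = m, …, i} ( D[j − 1, m − 1] + W[j, i] ). -/

import Mathlib

/-- Mean of the data block `x_a, …, x_{b-1}` (0-based, half-open interval). -/
noncomputable def blockMean (x : ℕ → ℝ) (a b : ℕ) : ℝ :=
  (∑ i ∈ Finset.Ico a b, x i) / ((b - a : ℕ) : ℝ)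

/-- Within-block sum of squares of the block `x_a, …, x_{b-1}`. -/
noncomputable def blockSS (x : ℕ → ℝ) (a b : ℕ) : ℝ :=
  ∑ i ∈ Finset.Ico a b, (x i - blockMean x a b) ^ 2

/-- `b` encodes a contiguous `m`-partition of the first `n` data points (0-based):
the `j`-th block is `{b j, …, b (j+1) - 1}`, each block nonempty. -/
def IsContigPartition (n m : ℕ) (b : ℕ → ℕ) : Prop :=
  b 0 = 0 ∧ b m = n ∧ ∀ j < m, b j < b (j + 1)

/-- Cost of a contiguous partition: sum of within-block sums of squares. -/
noncomputable def partCost (x : ℕ → ℝ) (m : ℕ) (b : ℕ → ℕ) : ℝ :=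
  ∑ j ∈ Finset.range m, blockSS x (b j) (b (j + 1))

lemma costs_bddBelow (x : ℕ → ℝ) (i m : ℕ) :
    BddBelow {c | ∃ b : ℕ → ℕ, IsContigPartition i m b ∧ c = partCost x m b} := by
  refine ⟨0, ?_⟩
  rintro c ⟨b, -, rfl⟩
  exact Finset.sum_nonneg fun j _ => Finset.sum_nonneg fun k _ => sq_nonneg _

lemma costs_nonempty (x : ℕ → ℝ) (i m : ℕ) (hm : 1 ≤ m) (hmi : m ≤ i) :
    {c | ∃ b : ℕ → ℕ, IsContigPartition i m b ∧ c = partCost x m b}.Nonempty := by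
  refine ⟨_, fun k => if k < m then k else i, ⟨?_, ?_, ?_⟩, rfl⟩
  · simp; omega
  · simp
  · intro j hj
    dsimp only
    split_ifs <;> omega

lemma part_ge (m : ℕ) (b : ℕ → ℕ) (h : ∀ j < m, b j < b (j + 1)) :
    ∀ j ≤ m, j ≤ b j := by
  intro j
  induction j with
  | zero => simp
  | succ j ih =>
    intro hj
    have := ih (by omega)
    have := h j (by omega)
    omega

/-- Bellman recursion for unconstrained one-dimensional K-means (the dynamic
program of Wang and Song): with `D[i,m]` the minimum cost over contiguous
`m`-partitions of the first `i` points, `D[i,1] = W[1,i]` and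
`D[i,m] = min_{j=m,…,i} (D[j-1,m-1] + W[j,i])` (indices `j` 1-based; in 0-based
terms the last block is `[j-1, i)`). -/
theorem bellman_recursion_one_dim_kmeans
    (N : ℕ) (x : ℕ → ℝ) (hx : ∀ i j, i ≤ j → j < N → x i ≤ x j)
    (D : ℕ → ℕ → ℝ)
    (hD : ∀ i m, D i m =
      sInf {c | ∃ b : ℕ → ℕ, IsContigPartition i m b ∧ c = partCost x m b}) :
    (∀ i, 1 ≤ i → i ≤ N → D i 1 = blockSS x 0 i) ∧
    (∀ m i, 2 ≤ m → (hmi : m ≤ i) → i ≤ N →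
      D i m = (Finset.Icc m i).inf' (Finset.nonempty_Icc.mpr hmi)
        (fun j => D (j - 1) (m - 1) + blockSS x (j - 1) i)) := by
  constructor
  · intro i h1 _
    rw [hD]
    apply le_antisymm
    · apply csInf_le (costs_bddBelow x i 1)
      refine ⟨fun k => if k = 0 then 0 else i, ⟨by simp, by simp, ?_⟩, by simp [partCost]⟩
      intro j hj
      have : j = 0 := by omega
      subst this
      simp; omega
    · apply le_csInf (costs_nonempty x i 1 le_rfl h1)
      rintro c ⟨b, ⟨h0, hb, -⟩, rfl⟩
      simp [partCost, h0, hb]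
  · intro m i h2 hmi _
    obtain ⟨k, rfl⟩ : ∃ k, m = k + 1 := ⟨m - 1, by omega⟩
    apply le_antisymm
    · apply Finset.le_inf'
      intro j hj
      rw [Finset.mem_Icc] at hj
      rw [← sub_le_iff_le_add, hD (j - 1)]
      simp only [Nat.add_sub_cancel]
      apply le_csInf (costs_nonempty x (j - 1) k (by omega) (by omega))
      rintro c ⟨b, ⟨h0, hb, hlt⟩, rfl⟩
      rw [sub_le_iff_le_add, hD]
      apply csInf_le (costs_bddBelow x i (k + 1))
      refine ⟨fun l => if l ≤ k then b l else i, ⟨by simp [h0], by simp, ?_⟩, ?_⟩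
      · intro l hl
        dsimp only
        rcases Nat.lt_or_ge l k with h | h
        · rw [if_pos (by omega), if_pos (by omega)]
          exact hlt l h
        · have : l = k := by omega
          subst this
          simp [hb]; omega
      · unfold partCost
        rw [Finset.sum_range_succ]
        congr 1
        · apply Finset.sum_congr rfl
          intro l hl
          rw [Finset.mem_range] at hl
          dsimp only
          rw [if_pos (by omega), if_pos (by omega)]
        · simp [hb]
    · rw [hD i]
      apply le_csInf (costs_nonempty x i (k + 1) (by omega) hmi)
      rintro c ⟨b, ⟨h0, hb, hlt⟩, rfl⟩
      have hk := part_ge (k + 1) b hlt k (by omega)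
      have hki := hlt k (by omega)
      have hmem : b k + 1 ∈ Finset.Icc (k + 1) i := by
        rw [Finset.mem_Icc]; omega
      refine (Finset.inf'_le _ hmem).trans ?_
      simp only [Nat.add_sub_cancel]
      unfold partCost
      rw [Finset.sum_range_succ, hb]
      gcongr
      rw [hD]
      apply csInf_le (costs_bddBelow x (b k) k)
      exact ⟨b, ⟨h0, rfl, fun j hj => hlt j (by omega)⟩, rfl⟩
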